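/- (Packing number of submatrix-sparse matrices in a unitarily invariant norm) There exist absolute constants c₁, c₂ > 0 such that for all integers p, m ≥ 1, 1 ≤ k ≤ p, 1 ≤ s ≤ m, and every unitarily invariant norm ‖·‖ on ℝ^{p×m}, there exists a finite set S ⊆ { A ∈ ℱ(k, s; p, m) : ‖A‖_F ≤ 1 } such that log |S| ≥ c₂ · ( k·log(e·p/k) + s·log(e·m/s) ) and ‖A − B‖ ≥ c₁ · L for all distinct A, B ∈ S, where L = sup{ ‖A‖ : A ∈ ℱ(k, s; p, m), ‖A‖_F = 1 }. -/

import Mathlib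

open Matrix

/-- `nrm` is a norm on the space of `p × m` real matrices. -/
def IsMatrixNorm {p m : ℕ} (nrm : Matrix (Fin p) (Fin m) ℝ → ℝ) : Prop :=
  (∀ A B, nrm (A + B) ≤ nrm A + nrm B) ∧
  (∀ (c : ℝ) A, nrm (c • A) = |c| * nrm A) ∧
  (∀ A, nrm A = 0 → A = 0)

/-- `nrm` is invariant under left and right multiplication by orthogonal matrices. -/
def IsUnitarilyInvariant {p m : ℕ} (nrm : Matrix (Fin p) (Fin m) ℝ → ℝ) : Prop :=
  ∀ (U : Matrix (Fin p) (Fin p) ℝ) (V : Matrix (Fin m) (Fin m) ℝ)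
    (A : Matrix (Fin p) (Fin m) ℝ), U * Uᵀ = 1 → V * Vᵀ = 1 → nrm (U * A * V) = nrm A

/-- The Frobenius norm of a real matrix. -/
noncomputable def frobNorm {p m : ℕ} (A : Matrix (Fin p) (Fin m) ℝ) : ℝ :=
  Real.sqrt (∑ i, ∑ j, (A i j) ^ 2)

/-- `ℱ(k, s; p, m)`: the set of `p × m` real matrices with at most `k` nonzero rows
and at most `s` nonzero columns. -/
def SubmatrixSparse (p m k s : ℕ) : Set (Matrix (Fin p) (Fin m) ℝ) :=
  {M | {i | ∃ j, M i j ≠ 0}.ncard ≤ k ∧ {j | ∃ i, M i j ≠ 0}.ncard ≤ s}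

/-- The restricted Lipschitz constant
`L = sup { ‖A‖ : A ∈ ℱ(k, s; p, m), ‖A‖_F = 1 }`. -/
noncomputable def sparseLip (p m k s : ℕ) (nrm : Matrix (Fin p) (Fin m) ℝ → ℝ) : ℝ :=
  sSup (nrm '' {A | A ∈ SubmatrixSparse p m k s ∧ frobNorm A = 1})

/-! ### Codes with linear Hamming distance -/

lemma card_hammingBall_le {k q : ℕ} {α : Type*} [Fintype α] [DecidableEq α]
    (hq : Fintype.card α = q) (hq1 : 1 ≤ q) (u : ℝ) (hu : 1 ≤ u) (hu8 : u ^ 8 = 4 * q)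
    (c : Fin k → α) :
    ((Finset.univ.filter fun x : Fin k → α => 8 * hammingDist x c < k).card : ℝ)
      ≤ (u * (5 / 4)) ^ k := by
  have hu0 : 0 < u := by linarith
  have hq0 : (1 : ℝ) ≤ q := by exact_mod_cast hq1
  set t : ℝ := (u ^ 8)⁻¹ with ht
  have ht0 : 0 < t := by positivity
  have hterm : ∀ x : Fin k → α, (if 8 * hammingDist x c < k then (1 : ℝ) else 0)
      ≤ u ^ k * ∏ i, (if x i ≠ c i then t else 1) := by
    intro x
    have hprod : ∏ i, (if x i ≠ c i then t else 1) = t ^ hammingDist x c := by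
      rw [Finset.prod_ite, Finset.prod_const, Finset.prod_const_one, mul_one]
      rfl
    rw [hprod]
    split_ifs with h
    · have : t ^ hammingDist x c = (u ^ (8 * hammingDist x c))⁻¹ := by
        rw [ht, inv_pow, pow_mul]
      rw [this, ← div_eq_mul_inv, one_le_div (by positivity)]
      exact pow_le_pow_right₀ hu h.le
    · positivity
  have hsum : ∑ x : Fin k → α, ∏ i, (if x i ≠ c i then t else 1)
      = ∏ i, ∑ a : α, (if a ≠ c i then t else 1) := by
    rw [Finset.prod_univ_sum, Fintype.piFinset_univ]
  have hone : ∀ i, ∑ a : α, (if a ≠ c i then t else 1) ≤ 5 / 4 := by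
    intro i
    have h1 : ∀ a : α, (if a ≠ c i then t else 1) = t + (if a = c i then 1 - t else 0) := by
      intro a; by_cases h : a = c i <;> simp [h]
    simp only [h1, Finset.sum_add_distrib, Finset.sum_const, Finset.card_univ, hq,
      Finset.sum_ite_eq', Finset.mem_univ, if_true, nsmul_eq_mul]
    have : (q : ℝ) * t = 1 / 4 := by
      rw [ht, hu8]; field_simp
    linarith
  have hcard : ((Finset.univ.filter fun x : Fin k → α => 8 * hammingDist x c < k).card : ℝ)
      = ∑ x : Fin k → α, (if 8 * hammingDist x c < k then (1 : ℝ) else 0) := by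
    simp
  rw [hcard]
  calc _ ≤ ∑ x : Fin k → α, u ^ k * ∏ i, (if x i ≠ c i then t else 1) :=
        Finset.sum_le_sum fun x _ => hterm x
    _ = u ^ k * ∏ i, ∑ a : α, (if a ≠ c i then t else 1) := by
        rw [← Finset.mul_sum, hsum]
    _ ≤ u ^ k * ∏ _i : Fin k, (5 / 4 : ℝ) := by
        refine mul_le_mul_of_nonneg_left (Finset.prod_le_prod (fun i _ => ?_) fun i _ => hone i)
          (by positivity)
        exact Finset.sum_nonneg fun a _ => by split_ifs <;> positivity
    _ = (u * (5 / 4)) ^ k := by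
        rw [Finset.prod_const, Finset.card_univ, Fintype.card_fin, mul_pow]

/-- A Gilbert–Varshamov bound: words of length `k` over an alphabet `α` with at least two letters
contain an exponentially large code of minimum distance at least `k / 8`. -/
lemma exists_code_hammingDist (k : ℕ) (hk : 1 ≤ k) (α : Type*) [Fintype α] [DecidableEq α]
    (hq : 2 ≤ Fintype.card α) :
    ∃ C : Finset (Fin k → α), (∀ x ∈ C, ∀ y ∈ C, x ≠ y → k ≤ 8 * hammingDist x y) ∧
      7 / 24 * (k * Real.log (Fintype.card α)) ≤ Real.log C.card := by
  classical
  obtain ⟨C, hCmem, hCmax⟩ := Finset.exists_max_image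
    (Finset.univ.filter fun C : Finset (Fin k → α) =>
      ∀ x ∈ C, ∀ y ∈ C, x ≠ y → k ≤ 8 * hammingDist x y) Finset.card ⟨∅, by simp⟩
  have hC := (Finset.mem_filter.1 hCmem).2
  have hcover : ∀ x, ∃ c ∈ C, 8 * hammingDist x c < k := by
    intro x
    by_contra! h
    have hx : x ∉ C := fun hx => by
      have := h x hx
      simp at this
      omega
    have := hCmax (insert x C) (by
      simp only [Finset.mem_filter, Finset.mem_univ, true_and]
      intro a ha b hb hab
      rcases Finset.mem_insert.1 ha with hax | haC <;> rcases Finset.mem_insert.1 hb with hbx | hbC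
      · exact absurd (hax.trans hbx.symm) hab
      · rw [hax]; exact h b hbC
      · rw [hbx, hammingDist_comm]; exact h a haC
      · exact hC a haC b hbC hab)
    rw [Finset.card_insert_of_notMem hx] at this
    omega
  obtain ⟨q, hqdef⟩ : ∃ q, q = Fintype.card α := ⟨_, rfl⟩
  rw [← hqdef] at hq ⊢
  have hq2 : (2 : ℝ) ≤ q := by exact_mod_cast hq
  set u : ℝ := (4 * q : ℝ) ^ ((8 : ℝ)⁻¹) with hu
  have hu8 : u ^ 8 = 4 * q := by
    rw [hu, ← Real.rpow_natCast, ← Real.rpow_mul (by positivity)]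
    norm_num
  have hu1 : 1 ≤ u := Real.one_le_rpow (by linarith) (by norm_num)
  have hne : C.Nonempty := by
    have : Nonempty α := Fintype.card_pos_iff.1 (by omega)
    obtain ⟨c, hc, -⟩ := hcover (fun _ => Classical.arbitrary α)
    exact ⟨c, hc⟩
  have hcount : (q : ℝ) ^ k ≤ C.card * (u * (5 / 4)) ^ k := by
    have h1 : (Finset.univ : Finset (Fin k → α)) ⊆ C.biUnion fun c =>
        Finset.univ.filter fun x => 8 * hammingDist x c < k := by
      intro x _
      obtain ⟨c, hc, h⟩ := hcover x
      simp only [Finset.mem_biUnion, Finset.mem_filter, Finset.mem_univ, true_and]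
      exact ⟨c, hc, h⟩
    have h2 := (Finset.card_le_card h1).trans Finset.card_biUnion_le
    have h3 : (q : ℝ) ^ k ≤ ∑ c ∈ C,
        ((Finset.univ.filter fun x : Fin k → α => 8 * hammingDist x c < k).card : ℝ) := by
      have : (Finset.univ : Finset (Fin k → α)).card = q ^ k := by
        simp [hqdef]
      rw [this] at h2
      exact_mod_cast h2
    refine h3.trans ((Finset.sum_le_sum fun c _ =>
      card_hammingBall_le hqdef.symm (by omega) u hu1 hu8 c).trans ?_)
    simp
  refine ⟨C, hC, ?_⟩
  have hC0 : (0 : ℝ) < C.card := by exact_mod_cast hne.card_pos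
  have hlog := Real.log_le_log (by positivity) hcount
  rw [Real.log_mul hC0.ne' (by positivity), Real.log_pow, Real.log_pow,
    Real.log_mul (by positivity) (by norm_num)] at hlog
  have hlu : 8 * Real.log u ≤ 3 * Real.log q := by
    have h := Real.log_le_log (by positivity) (show u ^ 8 ≤ (q : ℝ) ^ 3 by
      rw [hu8]; nlinarith [mul_le_mul hq2 hq2 (by norm_num) (by linarith)])
    simpa [Real.log_pow] using h
  have hl5 : 3 * Real.log (5 / 4) ≤ Real.log q := by
    have h := Real.log_le_log (by norm_num) (show (5 / 4 : ℝ) ^ 3 ≤ q by norm_num; linarith)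
    simpa [Real.log_pow] using h
  have hk0 : (0 : ℝ) ≤ k := by positivity
  have := mul_le_mul_of_nonneg_left
    (show Real.log u + Real.log (5 / 4) ≤ 17 / 24 * Real.log q by linarith) hk0
  linarith

/-! ### Equalizing row norms by an orthogonal matrix -/

lemma sum_sq_orthogonal_mul {p k m : ℕ} (F : Matrix (Fin p) (Fin k) ℝ) (hF : Fᵀ * F = 1)
    (a : Matrix (Fin k) (Fin m) ℝ) :
    ∑ i, ∑ j, (F * a) i j ^ 2 = ∑ i, ∑ j, a i j ^ 2 := by
  have h : ∀ {l : ℕ} (b : Matrix (Fin l) (Fin m) ℝ), ∑ i, ∑ j, b i j ^ 2 = (bᵀ * b).trace := by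
    intro l b
    rw [Finset.sum_comm]
    simp [Matrix.trace, Matrix.mul_apply, sq]
  rw [h, h, Matrix.transpose_mul, Matrix.mul_assoc, ← Matrix.mul_assoc Fᵀ, hF, Matrix.one_mul]

/-- A reflection mixing the rows `i` and `j` can give row `i` any intermediate norm. -/
lemma exists_reflection_row {k m : ℕ} (a : Matrix (Fin k) (Fin m) ℝ) {i j : Fin k} (hij : i ≠ j)
    {μ : ℝ} (hi : μ ≤ ∑ l, a i l ^ 2) (hj : ∑ l, a j l ^ 2 ≤ μ) :
    ∃ H : Matrix (Fin k) (Fin k) ℝ, H * Hᵀ = 1 ∧ ∑ l, (H * a) i l ^ 2 = μ ∧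
      ∀ r, r ≠ i → r ≠ j → ∀ l, (H * a) r l = a r l := by
  let g : ℝ → ℝ := fun φ => ∑ l, (a i l - 2 * Real.cos φ *
    (Real.cos φ * a i l - Real.sin φ * a j l)) ^ 2
  have hg : Continuous g := by fun_prop
  have hg0 : g 0 = ∑ l, a i l ^ 2 :=
    Finset.sum_congr rfl fun l _ => by simp; ring
  have hg1 : g (Real.pi / 4) = ∑ l, a j l ^ 2 := by
    refine Finset.sum_congr rfl fun l _ => ?_
    rw [Real.cos_pi_div_four, Real.sin_pi_div_four]
    have h2 : √2 * √2 = (2 : ℝ) := Real.mul_self_sqrt (by norm_num)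
    congr 1
    linear_combination (-(a i l) / 2 + a j l / 2) * h2
  obtain ⟨φ, -, hφ⟩ := intermediate_value_Icc' (by positivity : (0 : ℝ) ≤ Real.pi / 4)
    hg.continuousOn (show μ ∈ Set.Icc (g (Real.pi / 4)) (g 0) by rw [hg0, hg1]; exact ⟨hj, hi⟩)
  let u : Fin k → ℝ := Pi.single i (Real.cos φ) - Pi.single j (Real.sin φ)
  have hui : u i = Real.cos φ := by simp [u, hij]
  have hur : ∀ r, r ≠ i → r ≠ j → u r = 0 := fun r h1 h2 => by simp [u, h1, h2]
  have huu : u ⬝ᵥ u = 1 := by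
    simp [u, dotProduct_sub, hij, hij.symm]
    nlinarith [Real.sin_sq_add_cos_sq φ]
  have hrow : ∀ r l, ((1 - (2 : ℝ) • vecMulVec u u : Matrix (Fin k) (Fin k) ℝ) * a) r l
      = a r l - 2 * u r * (Real.cos φ * a i l - Real.sin φ * a j l) := by
    intro r l
    rw [Matrix.sub_mul, Matrix.one_mul, Matrix.smul_mul, Matrix.sub_apply, Matrix.smul_apply,
      Matrix.vecMulVec_mul, vecMulVec_apply]
    have : (u ᵥ* a) l = Real.cos φ * a i l - Real.sin φ * a j l := by
      simp [u, Matrix.sub_vecMul]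
    rw [this, smul_eq_mul]; ring
  refine ⟨1 - (2 : ℝ) • vecMulVec u u, ?_, ?_, ?_⟩
  · simp only [transpose_sub, transpose_one, transpose_smul, transpose_vecMulVec, Matrix.sub_mul,
      Matrix.mul_sub, Matrix.one_mul, Matrix.mul_one, Matrix.smul_mul, Matrix.mul_smul,
      vecMulVec_mul_vecMulVec, huu, one_smul]
    ext x y
    simp [vecMulVec_apply]
    ring
  · rw [← hφ]
    exact Finset.sum_congr rfl fun l _ => by rw [hrow, hui]
  · intro r h1 h2 l
    rw [hrow, hur r h1 h2]; ring

lemma exists_orthogonal_equal_rows_of_card {k m : ℕ} {μ : ℝ} (N : ℕ) :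
    ∀ a : Matrix (Fin k) (Fin m) ℝ, ∑ i, ∑ l, a i l ^ 2 = k * μ →
      (Finset.univ.filter fun i => ∑ l, a i l ^ 2 ≠ μ).card ≤ N →
      ∃ W : Matrix (Fin k) (Fin k) ℝ, W * Wᵀ = 1 ∧ ∀ i, ∑ l, (W * a) i l ^ 2 = μ := by
  induction N with
  | zero =>
    intro a _ hN
    refine ⟨1, by simp, fun i => ?_⟩
    have := Finset.card_eq_zero.1 (Nat.le_zero.1 hN)
    simpa using (Finset.filter_eq_empty_iff.1 this) (Finset.mem_univ i)
  | succ N ih =>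
    intro a ha hN
    by_cases hall : ∀ i, ∑ l, a i l ^ 2 = μ
    · exact ⟨1, by simp, by simpa using hall⟩
    push Not at hall
    obtain ⟨i₀, hi₀⟩ := hall
    have hzero : ∑ i, (∑ l, a i l ^ 2 - μ) = 0 := by
      rw [Finset.sum_sub_distrib, ha]; simp
    have hzero' : ∑ i, (μ - ∑ l, a i l ^ 2) = 0 := by
      rw [Finset.sum_sub_distrib, ha]; simp
    obtain ⟨i, -, hi⟩ := Finset.exists_pos_of_sum_zero_of_exists_nonzero _ hzero
      ⟨i₀, Finset.mem_univ _, sub_ne_zero.2 hi₀⟩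
    obtain ⟨j, -, hj⟩ := Finset.exists_pos_of_sum_zero_of_exists_nonzero _ hzero'
      ⟨i₀, Finset.mem_univ _, sub_ne_zero.2 hi₀.symm⟩
    have hij : i ≠ j := by rintro rfl; linarith
    obtain ⟨H, hH, hHi, hHr⟩ := exists_reflection_row a hij (μ := μ) (by linarith) (by linarith)
    have hlt : (Finset.univ.filter fun r => ∑ l, (H * a) r l ^ 2 ≠ μ).card
        < (Finset.univ.filter fun r => ∑ l, a r l ^ 2 ≠ μ).card := by
      refine Finset.card_lt_card (Finset.ssubset_iff_of_subset ?_ |>.2 ⟨i, ?_, ?_⟩)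
      · intro r hr
        simp only [Finset.mem_filter, Finset.mem_univ, true_and] at hr ⊢
        by_cases h1 : r = i
        · subst h1; exact absurd hHi hr
        by_cases h2 : r = j
        · subst h2; intro h; linarith
        · simpa only [hHr r h1 h2] using hr
      · simp only [Finset.mem_filter, Finset.mem_univ, true_and]
        intro h; linarith
      · simpa using hHi
    obtain ⟨W, hW, hWrow⟩ := ih (H * a)
      (by rw [sum_sq_orthogonal_mul H (mul_eq_one_comm.1 hH), ha]) (by omega)
    refine ⟨W * H, ?_, by simpa only [Matrix.mul_assoc] using hWrow⟩
    rw [transpose_mul, Matrix.mul_assoc, ← Matrix.mul_assoc H, hH, Matrix.one_mul, hW]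

lemma exists_orthogonal_equal_rows {k m : ℕ} {μ : ℝ} (a : Matrix (Fin k) (Fin m) ℝ)
    (ha : ∑ i, ∑ l, a i l ^ 2 = k * μ) :
    ∃ W : Matrix (Fin k) (Fin k) ℝ, W * Wᵀ = 1 ∧ ∀ i, ∑ l, (W * a) i l ^ 2 = μ :=
  exists_orthogonal_equal_rows_of_card _ a ha le_rfl

/-! ### Matrix norms and the constant `sparseLip` -/

lemma frobNorm_eq_one_iff {p m : ℕ} {A : Matrix (Fin p) (Fin m) ℝ} :
    frobNorm A = 1 ↔ ∑ i, ∑ j, A i j ^ 2 = 1 :=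
  Real.sqrt_eq_one

lemma IsMatrixNorm.map_zero {p m : ℕ} {nrm : Matrix (Fin p) (Fin m) ℝ → ℝ}
    (h : IsMatrixNorm nrm) : nrm 0 = 0 := by
  simpa using h.2.1 0 0

lemma IsMatrixNorm.nonneg {p m : ℕ} {nrm : Matrix (Fin p) (Fin m) ℝ → ℝ}
    (h : IsMatrixNorm nrm) (A : Matrix (Fin p) (Fin m) ℝ) : 0 ≤ nrm A := by
  have h1 := h.1 A ((-1 : ℝ) • A)
  rw [h.2.1] at h1
  simp [h.map_zero] at h1
  linarith

lemma IsMatrixNorm.bddAbove {p m : ℕ} {nrm : Matrix (Fin p) (Fin m) ℝ → ℝ}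
    (h : IsMatrixNorm nrm) (k s : ℕ) :
    BddAbove (nrm '' {A | A ∈ SubmatrixSparse p m k s ∧ frobNorm A = 1}) := by
  refine ⟨∑ i, ∑ j, nrm (Matrix.single i j 1), ?_⟩
  rintro _ ⟨A, ⟨-, hA⟩, rfl⟩
  rw [frobNorm_eq_one_iff] at hA
  have hentry : ∀ i j, |A i j| ≤ 1 := by
    intro i j
    rw [← sq_le_one_iff_abs_le_one]
    calc A i j ^ 2 ≤ ∑ j, A i j ^ 2 :=
          Finset.single_le_sum (f := fun j => A i j ^ 2) (fun _ _ => sq_nonneg _)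
            (Finset.mem_univ j)
      _ ≤ ∑ i, ∑ j, A i j ^ 2 :=
          Finset.single_le_sum (f := fun i => ∑ j, A i j ^ 2)
            (fun _ _ => Finset.sum_nonneg fun _ _ => sq_nonneg _) (Finset.mem_univ i)
      _ = 1 := hA
  conv_lhs => rw [Matrix.matrix_eq_sum_single A]
  refine (Finset.le_sum_of_subadditive nrm h.map_zero.le h.1 _ _).trans
    (Finset.sum_le_sum fun i _ => (Finset.le_sum_of_subadditive nrm h.map_zero.le h.1 _ _).trans
      (Finset.sum_le_sum fun j _ => ?_))
  have : Matrix.single i j (A i j) = A i j • Matrix.single i j (1 : ℝ) := by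
    simp [Matrix.smul_single]
  rw [this, h.2.1]
  exact mul_le_of_le_one_left (h.nonneg _) (hentry i j)

lemma le_sparseLip_mul_frobNorm {p m k s : ℕ} {nrm : Matrix (Fin p) (Fin m) ℝ → ℝ}
    (h : IsMatrixNorm nrm) {A : Matrix (Fin p) (Fin m) ℝ} (hA : A ∈ SubmatrixSparse p m k s) :
    nrm A ≤ sparseLip p m k s nrm * frobNorm A := by
  by_cases h0 : A = 0
  · subst h0; simp [h.map_zero, frobNorm]
  have hpos : 0 < frobNorm A := by
    refine Real.sqrt_pos.2 ?_
    obtain ⟨i, j, hij⟩ : ∃ i j, A i j ≠ 0 := by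
      by_contra! hc; exact h0 (by ext i j; exact hc i j)
    refine Finset.sum_pos' (fun _ _ => Finset.sum_nonneg fun _ _ => sq_nonneg _)
      ⟨i, Finset.mem_univ _, Finset.sum_pos' (fun _ _ => sq_nonneg _)
        ⟨j, Finset.mem_univ _, by positivity⟩⟩
  have hsq : ∑ i, ∑ j, A i j ^ 2 = frobNorm A ^ 2 :=
    (Real.sq_sqrt (Finset.sum_nonneg fun _ _ => Finset.sum_nonneg fun _ _ => sq_nonneg _)).symm
  have hle : nrm ((frobNorm A)⁻¹ • A) ≤ sparseLip p m k s nrm := by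
    refine le_csSup (h.bddAbove k s) ⟨_, ⟨?_, ?_⟩, rfl⟩
    · simpa [SubmatrixSparse, hpos.ne'] using hA
    · rw [frobNorm_eq_one_iff]
      simp only [Matrix.smul_apply, smul_eq_mul, mul_pow, ← Finset.mul_sum, hsq]
      field_simp
  rw [h.2.1, abs_of_pos (by positivity), inv_mul_le_iff₀ hpos] at hle
  linarith

lemma single_mem_sparse {p m k s : ℕ} (hk : 1 ≤ k) (hs : 1 ≤ s) (i : Fin p) (j : Fin m) :
    Matrix.single i j (1 : ℝ) ∈ {A | A ∈ SubmatrixSparse p m k s ∧ frobNorm A = 1} := by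
  refine ⟨⟨(Set.ncard_le_ncard (t := {i}) ?_).trans (by simpa),
    (Set.ncard_le_ncard (t := {j}) ?_).trans (by simpa)⟩, ?_⟩
  · rintro x ⟨y, hy⟩
    by_contra hx
    exact hy (by simp [Ne.symm hx])
  · rintro y ⟨x, hx⟩
    by_contra hy
    exact hx (by simp [Ne.symm hy])
  · rw [frobNorm_eq_one_iff]
    rw [Finset.sum_eq_single i, Finset.sum_eq_single j] <;>
      simp +contextual [Matrix.single_apply, eq_comm]

lemma sparseLip_pos {p m k s : ℕ} (hk : 1 ≤ k) (hkp : k ≤ p) (hs : 1 ≤ s) (hsm : s ≤ m)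
    {nrm : Matrix (Fin p) (Fin m) ℝ → ℝ} (h : IsMatrixNorm nrm) :
    0 < sparseLip p m k s nrm := by
  let i : Fin p := ⟨0, by omega⟩
  let j : Fin m := ⟨0, by omega⟩
  refine lt_of_lt_of_le (lt_of_le_of_ne (h.nonneg (Matrix.single i j 1)) fun h0 => ?_)
    (le_csSup (h.bddAbove k s) ⟨_, single_mem_sparse hk hs i j, rfl⟩)
  have := congrFun (congrFun (h.2.2 _ h0.symm) i) j
  simp at this

lemma exists_lt_nrm {p m k s : ℕ} (hk : 1 ≤ k) (hkp : k ≤ p) (hs : 1 ≤ s) (hsm : s ≤ m)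
    {nrm : Matrix (Fin p) (Fin m) ℝ → ℝ} {c : ℝ} (hc : c < sparseLip p m k s nrm) :
    ∃ A ∈ SubmatrixSparse p m k s, ∑ i, ∑ j, A i j ^ 2 = 1 ∧ c < nrm A := by
  obtain ⟨_, ⟨A, ⟨hA, hA1⟩, rfl⟩, hlt⟩ := exists_lt_of_lt_csSup
    (Set.Nonempty.image _ ⟨_, single_mem_sparse hk hs ⟨0, by omega⟩ ⟨0, by omega⟩⟩) hc
  exact ⟨A, hA, frobNorm_eq_one_iff.1 hA1, hlt⟩

/-! ### Isometric embeddings of rows -/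

/-- The matrix whose columns are the standard basis vectors indexed by `f`;
left multiplication by it places row `i` at position `f i`. -/
def rowEmbed {p k : ℕ} (f : Fin k → Fin p) : Matrix (Fin p) (Fin k) ℝ :=
  (1 : Matrix (Fin p) (Fin p) ℝ).submatrix id f

lemma rowEmbed_transpose_mul {p k : ℕ} (f g : Fin k → Fin p) :
    (rowEmbed f)ᵀ * rowEmbed g = Matrix.of fun i j => if f i = g j then 1 else 0 := by
  ext i j
  simp [rowEmbed, Matrix.mul_apply, Matrix.one_apply, eq_comm]

lemma rowEmbed_transpose_mul_self {p k : ℕ} {f : Fin k → Fin p} (hf : Function.Injective f) :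
    (rowEmbed f)ᵀ * rowEmbed f = 1 := by
  rw [rowEmbed_transpose_mul]
  ext i j
  simp [Matrix.one_apply, hf.eq_iff]

lemma rowEmbed_comp {p k : ℕ} (σ : Fin p → Fin p) (f : Fin k → Fin p) :
    rowEmbed σ * rowEmbed f = rowEmbed (σ ∘ f) := by
  ext i j
  simp [rowEmbed, Matrix.mul_apply, Matrix.one_apply]

lemma rowEmbed_mul_apply_eq_zero {p k m : ℕ} {f : Fin k → Fin p} {x : Fin p}
    (hx : x ∉ Set.range f) (a : Matrix (Fin k) (Fin m) ℝ) (j : Fin m) :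
    (rowEmbed f * a) x j = 0 := by
  rw [Matrix.mul_apply]
  refine Finset.sum_eq_zero fun i _ => ?_
  have : x ≠ f i := fun h => hx ⟨i, h.symm⟩
  simp [rowEmbed, this]

lemma rowEmbed_mul_mem_sparse {p k m s : ℕ} (f : Fin k → Fin p) (M : Matrix (Fin k) (Fin k) ℝ)
    {a : Matrix (Fin k) (Fin m) ℝ} (ha : {j | ∃ i, a i j ≠ 0}.ncard ≤ s) :
    rowEmbed f * (M * a) ∈ SubmatrixSparse p m k s := by
  refine ⟨(Set.ncard_le_ncard (t := Set.range f) ?_).trans ?_,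
    (Set.ncard_le_ncard ?_).trans ha⟩
  · rintro x ⟨j, hj⟩
    by_contra hx
    exact hj (rowEmbed_mul_apply_eq_zero hx _ _)
  · rw [← Set.image_univ]
    exact (Set.ncard_image_le).trans (by simp [Set.ncard_univ])
  · rintro j ⟨x, hx⟩
    by_contra hj
    refine hx ?_
    rw [← Matrix.mul_assoc, Matrix.mul_apply]
    refine Finset.sum_eq_zero fun i _ => ?_
    have : a i j = 0 := by by_contra h; exact hj ⟨i, h⟩
    simp [this]

lemma exists_rowEmbed_eq {p k m s : ℕ} (hkp : k ≤ p) {A : Matrix (Fin p) (Fin m) ℝ}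
    (hA : A ∈ SubmatrixSparse p m k s) :
    ∃ (f : Fin k → Fin p) (a : Matrix (Fin k) (Fin m) ℝ), Function.Injective f ∧
      {j | ∃ i, a i j ≠ 0}.ncard ≤ s ∧ A = rowEmbed f * a := by
  classical
  obtain ⟨K, hK, hKc⟩ := Finset.exists_superset_card_eq
    (s := {i | ∃ j, A i j ≠ 0}.toFinset) (n := k) (by
      rw [← Set.ncard_eq_toFinset_card']; exact hA.1) (by simpa using hkp)
  let f : Fin k → Fin p := K.orderEmbOfFin hKc
  have hf : Function.Injective f := (K.orderEmbOfFin hKc).injective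
  refine ⟨f, A.submatrix f id, hf, (Set.ncard_le_ncard ?_).trans hA.2, ?_⟩
  · rintro j ⟨i, hi⟩
    exact ⟨f i, hi⟩
  · ext x j
    by_cases hx : x ∈ Set.range f
    · obtain ⟨i, rfl⟩ := hx
      simp [rowEmbed, Matrix.mul_apply, Matrix.one_apply, hf.eq_iff]
    · rw [rowEmbed_mul_apply_eq_zero hx]
      by_contra h
      refine hx ?_
      have : x ∈ (K : Set (Fin p)) := by
        refine hK ?_
        simp only [Set.mem_toFinset, Set.mem_ofPred_eq]
        exact ⟨j, h⟩
      rwa [← Finset.range_orderEmbOfFin K hKc] at this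

lemma IsUnitarilyInvariant.mul_left {p m : ℕ} {nrm : Matrix (Fin p) (Fin m) ℝ → ℝ}
    (h : IsUnitarilyInvariant nrm) {U : Matrix (Fin p) (Fin p) ℝ} (hU : U * Uᵀ = 1)
    (A : Matrix (Fin p) (Fin m) ℝ) : nrm (U * A) = nrm A := by
  simpa using h U 1 A hU (by simp)

lemma IsUnitarilyInvariant.isometry_mul {p k m : ℕ} {nrm : Matrix (Fin p) (Fin m) ℝ → ℝ}
    (h : IsUnitarilyInvariant nrm) {F : Matrix (Fin p) (Fin k) ℝ} (hF : Fᵀ * F = 1)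
    {W : Matrix (Fin k) (Fin k) ℝ} (hW : W * Wᵀ = 1) (a : Matrix (Fin k) (Fin m) ℝ) :
    nrm (F * (W * a)) = nrm (F * a) := by
  have hFX : ∀ {l : ℕ} (X : Matrix (Fin k) (Fin l) ℝ), Fᵀ * (F * X) = X := by
    intro l X; rw [← Matrix.mul_assoc, hF, Matrix.one_mul]
  have hWX : ∀ {l : ℕ} (X : Matrix (Fin k) (Fin l) ℝ), W * (Wᵀ * X) = X := by
    intro l X; rw [← Matrix.mul_assoc, hW, Matrix.one_mul]
  have hU : (F * W * Fᵀ + (1 - F * Fᵀ)) * (F * W * Fᵀ + (1 - F * Fᵀ))ᵀ = 1 := by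
    simp only [transpose_add, transpose_sub, transpose_mul, transpose_one, transpose_transpose,
      Matrix.add_mul, Matrix.mul_add, Matrix.sub_mul, Matrix.mul_sub, Matrix.mul_assoc,
      Matrix.one_mul, Matrix.mul_one, hFX, hWX]
    abel
  have hUa : (F * W * Fᵀ + (1 - F * Fᵀ)) * (F * a) = F * (W * a) := by
    simp only [Matrix.add_mul, Matrix.sub_mul, Matrix.mul_assoc, Matrix.one_mul, hFX]
    abel
  rw [← hUa, h.mul_left hU]

lemma IsUnitarilyInvariant.projection_le {p k m : ℕ} {nrm : Matrix (Fin p) (Fin m) ℝ → ℝ}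
    (h : IsUnitarilyInvariant nrm) (hn : IsMatrixNorm nrm) {F : Matrix (Fin p) (Fin k) ℝ}
    (hF : Fᵀ * F = 1) (X : Matrix (Fin p) (Fin m) ℝ) : nrm (F * (Fᵀ * X)) ≤ nrm X := by
  have hFX : ∀ {l : ℕ} (X : Matrix (Fin k) (Fin l) ℝ), Fᵀ * (F * X) = X := by
    intro l X; rw [← Matrix.mul_assoc, hF, Matrix.one_mul]
  have hU : ((2 : ℝ) • (F * Fᵀ) - 1) * ((2 : ℝ) • (F * Fᵀ) - 1)ᵀ = 1 := by
    simp only [transpose_sub, transpose_smul, transpose_mul, transpose_one, transpose_transpose,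
      Matrix.sub_mul, Matrix.mul_sub, Matrix.smul_mul, Matrix.mul_smul, Matrix.mul_assoc,
      Matrix.one_mul, Matrix.mul_one, hFX]
    module
  have hX : F * (Fᵀ * X) = (1 / 2 : ℝ) • (X + ((2 : ℝ) • (F * Fᵀ) - 1) * X) := by
    simp only [Matrix.sub_mul, Matrix.smul_mul, Matrix.one_mul, Matrix.mul_assoc]
    module
  rw [hX, hn.2.1]
  have := hn.1 X (((2 : ℝ) • (F * Fᵀ) - 1) * X)
  rw [h.mul_left hU] at this
  rw [abs_of_pos (by norm_num)]
  linarith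

lemma IsUnitarilyInvariant.rowEmbed_mul {p k m : ℕ} {nrm : Matrix (Fin p) (Fin m) ℝ → ℝ}
    (h : IsUnitarilyInvariant nrm) {f g : Fin k → Fin p} (hf : Function.Injective f)
    (hg : Function.Injective g) (a : Matrix (Fin k) (Fin m) ℝ) :
    nrm (rowEmbed g * a) = nrm (rowEmbed f * a) := by
  obtain ⟨σ, hσ⟩ := Equiv.Perm.exists_extending_pair f g hf hg
  have hgf : g = σ ∘ f := funext fun i => (hσ i).symm
  rw [hgf, ← rowEmbed_comp, Matrix.mul_assoc,
    h.mul_left (mul_eq_one_comm.1 (rowEmbed_transpose_mul_self σ.injective))]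

/-! ### Packings obtained by moving rows -/

/-- If `Fᵀ * F' = diagonal c` is far from the identity in the sense of `hfar`, then `F * a` and
`F' * a` are far apart, provided `F * a` nearly attains `sparseLip`. -/
lemma isometry_mul_separated {p m k s : ℕ} {nrm : Matrix (Fin p) (Fin m) ℝ → ℝ}
    (hn : IsMatrixNorm nrm) (hu : IsUnitarilyInvariant nrm)
    (F F' : Matrix (Fin p) (Fin k) ℝ) (hF : Fᵀ * F = 1) (c : Fin k → ℝ)
    (hFF' : Fᵀ * F' = diagonal c) (a : Matrix (Fin k) (Fin m) ℝ)
    (hsparse : ∀ M : Matrix (Fin k) (Fin k) ℝ, F * (M * a) ∈ SubmatrixSparse p m k s)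
    (hfar : ∑ i, ((1 + c i) / 2) ^ 2 * ∑ j, a i j ^ 2 ≤ (61 / 64) ^ 2)
    (hmax : 63 / 64 * sparseLip p m k s nrm ≤ nrm (F * a)) (hL : 0 ≤ sparseLip p m k s nrm) :
    1 / 16 * sparseLip p m k s nrm ≤ nrm (F * a - F' * a) := by
  have hsplit : F * a = F * (diagonal (fun i => (1 + c i) / 2) * a)
      + (1 / 2 : ℝ) • (F * (Fᵀ * (F * a - F' * a))) := by
    have h1 : Fᵀ * (F * a - F' * a) = a - diagonal c * a := by
      rw [Matrix.mul_sub, ← Matrix.mul_assoc, ← Matrix.mul_assoc, hF, hFF', Matrix.one_mul]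
    rw [h1, ← Matrix.mul_smul, ← Matrix.mul_add]
    congr 1
    ext i j
    simp [Matrix.diagonal_mul]
    ring
  have h1 := hn.1 (F * (diagonal (fun i => (1 + c i) / 2) * a))
    ((1 / 2 : ℝ) • (F * (Fᵀ * (F * a - F' * a))))
  rw [← hsplit, hn.2.1, abs_of_pos (by norm_num)] at h1
  have h2 := hu.projection_le hn hF (F * a - F' * a)
  have h3 := le_sparseLip_mul_frobNorm hn (hsparse (diagonal fun i => (1 + c i) / 2))
  have h4 : frobNorm (F * (diagonal (fun i => (1 + c i) / 2) * a)) ≤ 61 / 64 := by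
    refine Real.sqrt_le_iff.2 ⟨by norm_num, ?_⟩
    rw [sum_sq_orthogonal_mul F hF]
    simpa only [Matrix.diagonal_mul, mul_pow, ← Finset.mul_sum] using hfar
  have h5 := mul_le_mul_of_nonneg_left h4 hL
  linarith

lemma exists_row_packing {p m k s : ℕ} (hk : 1 ≤ k) (hkp : k ≤ p) (hs : 1 ≤ s) (hsm : s ≤ m)
    {nrm : Matrix (Fin p) (Fin m) ℝ → ℝ} (hn : IsMatrixNorm nrm) (hu : IsUnitarilyInvariant nrm) :
    ∃ S : Finset (Matrix (Fin p) (Fin m) ℝ),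
      (∀ A ∈ S, A ∈ SubmatrixSparse p m k s ∧ frobNorm A ≤ 1) ∧
      7 / 72 * ((k : ℝ) * Real.log (Real.exp 1 * p / k)) ≤ Real.log S.card ∧
      ∀ A ∈ S, ∀ B ∈ S, A ≠ B → 1 / 16 * sparseLip p m k s nrm ≤ nrm (A - B) := by
  classical
  have hL := sparseLip_pos hk hkp hs hsm hn
  have hk0 : (0 : ℝ) < k := by exact_mod_cast hk
  obtain ⟨A, hA, hA1, hAlt⟩ := exists_lt_nrm hk hkp hs hsm
    (show 63 / 64 * sparseLip p m k s nrm < sparseLip p m k s nrm by linarith)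
  obtain ⟨f, a₀, hf, ha₀, rfl⟩ := exists_rowEmbed_eq hkp hA
  have hF := rowEmbed_transpose_mul_self hf
  rw [sum_sq_orthogonal_mul _ hF] at hA1
  obtain ⟨W, hW, hrow⟩ := exists_orthogonal_equal_rows (μ := 1 / k) a₀
    (by rw [hA1]; field_simp)
  rw [← hu.isometry_mul hF hW] at hAlt
  set a := W * a₀ with ha
  set n := p / k
  have hn1 : 1 ≤ n := Nat.div_pos hkp hk
  obtain ⟨e⟩ : Nonempty (Fin k × Fin n ↪ Fin p) :=
    Function.Embedding.nonempty_of_card_le (by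
      simpa using Nat.mul_div_le p k)
  let g : (Fin k → Fin n × Bool) → Fin k → Fin p := fun w i => e (i, (w i).1)
  let ε : Bool → ℝ := fun b => if b then 1 else -1
  have hε : ∀ b, ε b * ε b = 1 := by intro b; cases b <;> simp [ε]
  let D : (Fin k → Fin n × Bool) → Matrix (Fin k) (Fin k) ℝ :=
    fun w => diagonal fun i => ε (w i).2
  have hD : ∀ w, D w * (D w)ᵀ = 1 := fun w => by
    simp [D, hε]
  have hg : ∀ w, Function.Injective (g w) := by
    intro w i j hij
    exact (Prod.mk.inj (e.injective hij)).1
  let F : (Fin k → Fin n × Bool) → Matrix (Fin p) (Fin k) ℝ := fun w => rowEmbed (g w) * D w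
  let c : (Fin k → Fin n × Bool) → (Fin k → Fin n × Bool) → Fin k → ℝ := fun w w' i =>
    if (w i).1 = (w' i).1 then ε (w i).2 * ε (w' i).2 else 0
  have hFF : ∀ w w', (F w)ᵀ * F w' = diagonal (c w w') := by
    intro w w'
    have : (rowEmbed (g w))ᵀ * rowEmbed (g w')
        = diagonal fun i => if (w i).1 = (w' i).1 then 1 else 0 := by
      rw [rowEmbed_transpose_mul]
      ext i j
      by_cases hij : i = j
      · subst hij; simp [g, e.injective.eq_iff]
      · simp [g, e.injective.eq_iff, hij]
    simp only [F, transpose_mul, Matrix.mul_assoc]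
    rw [← Matrix.mul_assoc (rowEmbed (g w))ᵀ, this]
    simp only [D, diagonal_transpose, diagonal_mul_diagonal]
    congr 1
    ext i
    simp [c]
  have hFw : ∀ w, (F w)ᵀ * F w = 1 := by
    intro w
    rw [hFF, ← diagonal_one]
    congr 1
    ext i
    simp [c, hε]
  have hsparse : ∀ w (M : Matrix (Fin k) (Fin k) ℝ), F w * (M * a) ∈ SubmatrixSparse p m k s := by
    intro w M
    have := rowEmbed_mul_mem_sparse (g w) (D w * M * W) ha₀
    simpa only [F, ha, Matrix.mul_assoc] using this
  have hmax : ∀ w, 63 / 64 * sparseLip p m k s nrm ≤ nrm (F w * a) := by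
    intro w
    simp only [F, Matrix.mul_assoc]
    rw [hu.isometry_mul (rowEmbed_transpose_mul_self (hg w)) (hD w), hu.rowEmbed_mul hf (hg w)]
    exact hAlt.le
  obtain ⟨C, hC, hCcard⟩ := exists_code_hammingDist k hk (Fin n × Bool) (by
    simp; omega)
  have hsep : ∀ w ∈ C, ∀ w' ∈ C, w ≠ w' →
      1 / 16 * sparseLip p m k s nrm ≤ nrm (F w * a - F w' * a) := by
    intro w hw w' hw' hne
    refine isometry_mul_separated hn hu (F w) (F w') (hFw w) (c w w') (hFF w w') a (hsparse w)
      ?_ (hmax w) hL.le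
    have hterm : ∀ i, ((1 + c w w' i) / 2) ^ 2 * ∑ j, a i j ^ 2
        ≤ 1 / k - 3 / 4 * (1 / k) * (if w i ≠ w' i then 1 else 0) := by
      intro i
      rw [hrow i]
      have hc : ((1 + c w w' i) / 2) ^ 2 ≤ 1 - 3 / 4 * (if w i ≠ w' i then 1 else 0) := by
        rcases hw1 : w i with ⟨x, b⟩
        rcases hw2 : w' i with ⟨x', b'⟩
        by_cases hx : x = x' <;> cases b <;> cases b' <;>
          simp [c, ε, hw1, hw2, hx] <;> norm_num
      have := mul_le_mul_of_nonneg_right hc (show (0 : ℝ) ≤ 1 / k by positivity)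
      linarith
    refine (Finset.sum_le_sum fun i _ => hterm i).trans ?_
    have hham : ∑ i, (if w i ≠ w' i then (1 : ℝ) else 0) = hammingDist w w' := by
      rw [Finset.sum_boole]; rfl
    rw [Finset.sum_sub_distrib, ← Finset.mul_sum, hham]
    have h8 : (k : ℝ) ≤ 8 * hammingDist w w' := by exact_mod_cast hC w hw w' hw' hne
    have h9 : (1 : ℝ) / 8 ≤ 1 / k * hammingDist w w' := by
      rw [one_div_mul_eq_div, le_div_iff₀ hk0]; linarith
    have h10 : ∑ _i : Fin k, (1 : ℝ) / k = 1 := by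
      simp; field_simp
    rw [h10]
    linarith
  refine ⟨C.image fun w => F w * a, ?_, ?_, ?_⟩
  · intro B hB
    obtain ⟨w, -, rfl⟩ := Finset.mem_image.1 hB
    refine ⟨by simpa using hsparse w 1, (frobNorm_eq_one_iff.2 ?_).le⟩
    rw [sum_sq_orthogonal_mul _ (hFw w), Finset.sum_congr rfl fun i _ => hrow i]
    simp; field_simp
  · rw [Finset.card_image_of_injOn]
    · refine le_trans ?_ hCcard
      have hcard : ((Fintype.card (Fin n × Bool) : ℕ) : ℝ) = 2 * n := by
        simp [mul_comm]
      rw [hcard]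
      have hn1' : (1 : ℝ) ≤ n := by exact_mod_cast hn1
      have hp0 : (0 : ℝ) < p := by exact_mod_cast (by omega : 0 < p)
      have hlog2 : 1 / 2 ≤ Real.log (2 * n) := by
        have := Real.log_le_log (by norm_num) (show (2 : ℝ) ≤ 2 * n by linarith)
        linarith [Real.log_two_gt_d9]
      have hpk : (p : ℝ) / k ≤ 2 * n := by
        rw [div_le_iff₀ hk0]
        have : p < (n + 1) * k := by
          rw [mul_comm]; exact Nat.lt_mul_div_succ p hk
        have : (p : ℝ) < (n + 1) * k := by exact_mod_cast this
        nlinarith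
      have hlog : Real.log (Real.exp 1 * p / k) ≤ 3 * Real.log (2 * n) := by
        rw [mul_div_assoc, Real.log_mul (by positivity) (by positivity), Real.log_exp]
        have := Real.log_le_log (by positivity) hpk
        linarith
      have := mul_le_mul_of_nonneg_left hlog hk0.le
      linarith
    · intro w hw w' hw' heq
      by_contra hne
      have := hsep w hw w' hw' hne
      simp only at heq
      rw [heq, sub_self, hn.map_zero] at this
      linarith
  · intro B hB B' hB' hne
    obtain ⟨w, hw, rfl⟩ := Finset.mem_image.1 hB
    obtain ⟨w', hw', rfl⟩ := Finset.mem_image.1 hB'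
    exact hsep w hw w' hw' fun h => hne (by rw [h])

/-! ### Transposition -/

lemma frobNorm_transpose {p m : ℕ} (A : Matrix (Fin p) (Fin m) ℝ) :
    frobNorm Aᵀ = frobNorm A := by
  simp only [frobNorm, transpose_apply]
  rw [Finset.sum_comm]

lemma transpose_mem_sparse {p m k s : ℕ} {A : Matrix (Fin p) (Fin m) ℝ} :
    Aᵀ ∈ SubmatrixSparse m p s k ↔ A ∈ SubmatrixSparse p m k s :=
  and_comm

lemma sparseLip_transpose {p m : ℕ} (k s : ℕ) (nrm : Matrix (Fin p) (Fin m) ℝ → ℝ) :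
    sparseLip m p s k (fun A => nrm Aᵀ) = sparseLip p m k s nrm := by
  unfold sparseLip
  congr 1
  ext x
  constructor
  · rintro ⟨A, ⟨h1, h2⟩, rfl⟩
    exact ⟨Aᵀ, ⟨transpose_mem_sparse.2 h1, by rw [frobNorm_transpose, h2]⟩, rfl⟩
  · rintro ⟨A, ⟨h1, h2⟩, rfl⟩
    exact ⟨Aᵀ, ⟨transpose_mem_sparse.2 h1, by rw [frobNorm_transpose, h2]⟩, rfl⟩

lemma IsMatrixNorm.transpose {p m : ℕ} {nrm : Matrix (Fin p) (Fin m) ℝ → ℝ}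
    (h : IsMatrixNorm nrm) : IsMatrixNorm fun A : Matrix (Fin m) (Fin p) ℝ => nrm Aᵀ :=
  ⟨fun A B => h.1 Aᵀ Bᵀ, fun c A => h.2.1 c Aᵀ, fun A hA => by simpa using h.2.2 Aᵀ hA⟩

lemma IsUnitarilyInvariant.transpose {p m : ℕ} {nrm : Matrix (Fin p) (Fin m) ℝ → ℝ}
    (h : IsUnitarilyInvariant nrm) :
    IsUnitarilyInvariant fun A : Matrix (Fin m) (Fin p) ℝ => nrm Aᵀ := by
  intro U V A hU hV
  simp only [transpose_mul]
  rw [← Matrix.mul_assoc]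
  exact h Vᵀ Uᵀ Aᵀ (by simpa using mul_eq_one_comm.1 hV) (by simpa using mul_eq_one_comm.1 hU)

lemma exists_column_packing {p m k s : ℕ} (hk : 1 ≤ k) (hkp : k ≤ p) (hs : 1 ≤ s) (hsm : s ≤ m)
    {nrm : Matrix (Fin p) (Fin m) ℝ → ℝ} (hn : IsMatrixNorm nrm) (hu : IsUnitarilyInvariant nrm) :
    ∃ S : Finset (Matrix (Fin p) (Fin m) ℝ),
      (∀ A ∈ S, A ∈ SubmatrixSparse p m k s ∧ frobNorm A ≤ 1) ∧
      7 / 72 * ((s : ℝ) * Real.log (Real.exp 1 * m / s)) ≤ Real.log S.card ∧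
      ∀ A ∈ S, ∀ B ∈ S, A ≠ B → 1 / 16 * sparseLip p m k s nrm ≤ nrm (A - B) := by
  classical
  obtain ⟨S, hS, hcard, hsep⟩ := exists_row_packing hs hsm hk hkp hn.transpose hu.transpose
  refine ⟨S.image Matrix.transpose, ?_, ?_, ?_⟩
  · intro A hA
    obtain ⟨B, hB, rfl⟩ := Finset.mem_image.1 hA
    rw [frobNorm_transpose]
    exact ⟨transpose_mem_sparse.2 (hS B hB).1, (hS B hB).2⟩
  · rwa [Finset.card_image_of_injective _ Matrix.transpose_injective]
  · intro A hA B hB hne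
    obtain ⟨A', hA', rfl⟩ := Finset.mem_image.1 hA
    obtain ⟨B', hB', rfl⟩ := Finset.mem_image.1 hB
    have := hsep A' hA' B' hB' fun h => hne (by rw [h])
    rwa [sparseLip_transpose] at this

/-- Packing number of submatrix-sparse matrices in a unitarily invariant
norm: there are absolute constants `c₁, c₂ > 0` such that for all `1 ≤ k ≤ p`,
`1 ≤ s ≤ m` and every unitarily invariant norm `‖·‖` on `ℝ^{p×m}`, there is a finite
set `S` in the Frobenius unit ball of `ℱ(k, s; p, m)` with
`log |S| ≥ c₂ (k log(ep/k) + s log(em/s))` whose distinct elements are `c₁·L`-separated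
in the norm `‖·‖`. -/
theorem submatrix_sparse_packing :
    ∃ c₁ c₂ : ℝ, 0 < c₁ ∧ 0 < c₂ ∧
      ∀ (p m k s : ℕ), 1 ≤ k → k ≤ p → 1 ≤ s → s ≤ m →
        ∀ nrm : Matrix (Fin p) (Fin m) ℝ → ℝ,
          IsMatrixNorm nrm → IsUnitarilyInvariant nrm →
          ∃ S : Finset (Matrix (Fin p) (Fin m) ℝ),
            (∀ A ∈ S, A ∈ SubmatrixSparse p m k s ∧ frobNorm A ≤ 1) ∧
            c₂ * ((k : ℝ) * Real.log (Real.exp 1 * p / k) +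
                  (s : ℝ) * Real.log (Real.exp 1 * m / s)) ≤ Real.log S.card ∧
            ∀ A ∈ S, ∀ B ∈ S, A ≠ B → c₁ * sparseLip p m k s nrm ≤ nrm (A - B) := by
  refine ⟨1 / 16, 7 / 144, by norm_num, by norm_num, ?_⟩
  intro p m k s hk hkp hs hsm nrm hn hu
  obtain ⟨S, hS, hcard, hsep⟩ := exists_row_packing hk hkp hs hsm hn hu
  obtain ⟨T, hT, hcard', hsep'⟩ := exists_column_packing hk hkp hs hsm hn hu
  rcases le_total ((k : ℝ) * Real.log (Real.exp 1 * p / k))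
    ((s : ℝ) * Real.log (Real.exp 1 * m / s)) with h | h
  · exact ⟨T, hT, by linarith, hsep'⟩
  · exact ⟨S, hS, by linarith, hsep⟩
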